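/- Let d be a real number with 0 ≤ d < 1/2. Then the iterated integral ∫₀¹∫₀^{y₁}∫₀^{y₂}∫₀^{y₃}∫₀^{y₄} (y₁−y₃)^(−d)(y₂−y₄)^(−d)(y₁−y₄)^(−d)(y₂−y₅)^(−d)(y₃−y₅)^(−d) dy₅ dy₄ dy₃ dy₂ dy₁ equals (Γ(1−d)²/(2(1−d)²))·(Γ(4−5d)/(Γ(6−5d)·Γ(2−2d)))·₃F₂(1, d, 2−2d; 2−d, 3−2d; 1) − (Γ(1−d)/(1−d)²)·(Γ(3−3d)/Γ(4−4d))·(Γ(4−5d)/Γ(6−5d))·₄F₃(1, d, 2−2d, 3−3d; 2−d, 3−2d, 4−4d; 1). -/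

import Mathlib

open Real

noncomputable def poch (a : ℝ) (k : ℕ) : ℝ := ∏ i ∈ Finset.range k, (a + i)

noncomputable def F21 (a b c x : ℝ) : ℝ :=
  ∑' k : ℕ, poch a k * poch b k / (poch c k * (Nat.factorial k : ℝ)) * x ^ k

noncomputable def F32 (a b c e f : ℝ) : ℝ :=
  ∑' k : ℕ, poch a k * poch b k * poch c k / (poch e k * poch f k * (Nat.factorial k : ℝ))

noncomputable def F32x (a b c e f x : ℝ) : ℝ :=
  ∑' k : ℕ, poch a k * poch b k * poch c k / (poch e k * poch f k * (Nat.factorial k : ℝ)) * x ^ k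

noncomputable def F43 (a b c g e f h : ℝ) : ℝ :=
  ∑' k : ℕ, poch a k * poch b k * poch c k * poch g k /
    (poch e k * poch f k * poch h k * (Nat.factorial k : ℝ))

open MeasureTheory
open scoped ENNReal

noncomputable def q (a t : ℝ) : ℝ≥0∞ := if 0 < t then ENNReal.ofReal (t^a) else 0

@[fun_prop]
lemma q_meas (a : ℝ) : Measurable (q a) := by
  unfold q
  exact Measurable.ite measurableSet_Ioi (by fun_prop) measurable_const

@[fun_prop]
lemma meas_lint {α β : Type*} [MeasurableSpace α] [MeasurableSpace β] {μ : Measure β} [SFinite μ]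
    {f : α → β → ℝ≥0∞} (hf : Measurable fun p : α × β => f p.1 p.2) :
    Measurable fun x => ∫⁻ y, f x y ∂μ :=
  Measurable.lintegral_prod_right hf

lemma q_pos {a t : ℝ} (h : 0 < t) : q a t = ENNReal.ofReal (t^a) := by simp [q, h]
lemma q_neg {a t : ℝ} (h : ¬ 0 < t) : q a t = 0 := by simp [q, h]
lemma q_zero_pos {t : ℝ} (h : 0 < t) : q 0 t = 1 := by simp [q, h]
lemma q_ne_top (a t : ℝ) : q a t ≠ ∞ := by unfold q; split_ifs <;> simp

lemma q_mul (a b t : ℝ) : q a t * q b t = q (a+b) t := by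
  by_cases h : 0 < t
  · rw [q_pos h, q_pos h, q_pos h, ← ENNReal.ofReal_mul (by positivity), Real.rpow_add h]
  · simp [q_neg h]

lemma q_scale (a t : ℝ) {L : ℝ} (hL : 0 < L) : q a (L * t) = ENNReal.ofReal (L^a) * q a t := by
  by_cases h : 0 < t
  · rw [q_pos h, q_pos (mul_pos hL h), ← ENNReal.ofReal_mul (by positivity),
      Real.mul_rpow hL.le h.le]
  · have : ¬ 0 < L * t := by
      intro h'; exact h (pos_of_mul_pos_right h' hL.le)
    simp [q_neg h, q_neg this]

lemma lint_scale (f : ℝ → ℝ≥0∞) (hf : Measurable f) {L : ℝ} (hL : 0 < L) :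
    ∫⁻ y, f y = ENNReal.ofReal L * ∫⁻ x, f (L * x) := by
  conv_lhs => rw [← Real.smul_map_volume_mul_left hL.ne']
  rw [lintegral_smul_measure, lintegral_map hf (by fun_prop), abs_of_pos hL]
  rfl

lemma lint_affine (f : ℝ → ℝ≥0∞) (hf : Measurable f) (c : ℝ) {L : ℝ} (hL : 0 < L) :
    ∫⁻ y, f y = ENNReal.ofReal L * ∫⁻ x, f (c + L * x) := by
  rw [← lintegral_add_left_eq_self f c]
  exact lint_scale (fun y => f (c + y)) (by fun_prop) hL

open ProbabilityTheory in
lemma lint_beta {a b : ℝ} (ha : -1 < a) (hb : -1 < b) :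
    ∫⁻ t, q a t * q b (1 - t) = ENNReal.ofReal (beta (a+1) (b+1)) := by
  have hB : 0 < beta (a+1) (b+1) := beta_pos (by linarith) (by linarith)
  have h := lintegral_betaPDF_eq_one (α := a+1) (β := b+1) (by linarith) (by linarith)
  have : ∀ t, q a t * q b (1-t) = ENNReal.ofReal (beta (a+1) (b+1)) * betaPDF (a+1) (b+1) t := by
    intro t
    by_cases h1 : 0 < t
    · by_cases h2 : t < 1
      · have h2' : 0 < 1 - t := by linarith
        rw [q_pos h1, q_pos h2', betaPDF_of_pos_lt_one h1 h2, ← ENNReal.ofReal_mul (by positivity),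
          ← ENNReal.ofReal_mul hB.le]
        congr 1
        simp only [add_sub_cancel_right]
        field_simp
      · rw [q_neg (t := 1 - t) (by linarith), betaPDF_eq_zero_of_one_le (by linarith)]; simp
    · rw [q_neg h1, betaPDF_eq_zero_of_nonpos (by linarith)]; simp
  simp_rw [this]
  rw [lintegral_const_mul' _ _ ENNReal.ofReal_ne_top, h, mul_one]

open ProbabilityTheory in
lemma lint_conv {a b : ℝ} (ha : -1 < a) (hb : -1 < b) (x : ℝ) :
    ∫⁻ w, q a w * q b (x - w) = ENNReal.ofReal (beta (a+1) (b+1)) * q (a+b+1) x := by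
  by_cases hx : 0 < x
  · rw [lint_scale _ (by fun_prop) hx]
    have : ∀ t, q a (x * t) * q b (x - x * t) =
        ENNReal.ofReal (x^a) * ENNReal.ofReal (x^b) * (q a t * q b (1-t)) := by
      intro t
      rw [show x - x * t = x * (1 - t) by ring, q_scale _ _ hx, q_scale _ _ hx]; ring
    simp_rw [this]
    rw [lintegral_const_mul' _ _ (by finiteness), lint_beta ha hb, q_pos hx, Real.rpow_add hx,
      Real.rpow_add hx, Real.rpow_one, ENNReal.ofReal_mul (by positivity),
      ENNReal.ofReal_mul (by positivity)]
    ring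
  · rw [q_neg hx, mul_zero]
    have : ∀ w, q a w * q b (x - w) = 0 := by
      intro w
      by_cases hw : 0 < w
      · rw [q_neg (t := x - w) (by linarith)]; simp
      · rw [q_neg hw]; simp
    simp [this]

lemma poch_nonneg {a : ℝ} (ha : 0 ≤ a) (k : ℕ) : 0 ≤ poch a k :=
  Finset.prod_nonneg fun i _ => by positivity

lemma poch_pos {a : ℝ} (ha : 0 < a) (k : ℕ) : 0 < poch a k :=
  Finset.prod_pos fun i _ => by positivity

lemma poch_succ (a : ℝ) (k : ℕ) : poch a (k+1) = poch a k * (a + k) := by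
  simp [poch, Finset.prod_range_succ]

lemma poch_one (k : ℕ) : poch 1 k = k.factorial := by
  induction k with
  | zero => simp [poch]
  | succ k ih => rw [poch_succ, ih, Nat.factorial_succ]; push_cast; ring

lemma Gamma_add_nat {s : ℝ} (hs : 0 < s) (k : ℕ) : Gamma (s + k) = poch s k * Gamma s := by
  induction k with
  | zero => simp [poch]
  | succ k ih =>
    rw [poch_succ, Nat.cast_succ, ← add_assoc, Real.Gamma_add_one (by positivity), ih]; ring

lemma choose_eq (d : ℝ) (k : ℕ) : Ring.choose (d + k - 1) k = poch d k / k.factorial := by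
  have h := Ring.factorial_nsmul_multichoose_eq_ascPochhammer d k
  rw [Ring.choose, show d + k - 1 - k + 1 = d by ring]
  rw [nsmul_eq_mul] at h
  rw [eq_div_iff (by positivity), mul_comm, h]
  clear h
  induction k with
  | zero => simp [poch]
  | succ k ih =>
    rw [poch_succ, ← ih]
    simp [ascPochhammer_succ_right, Polynomial.smeval_mul, Polynomial.smeval_add, Polynomial.smeval_X,
      Polynomial.smeval_natCast]

lemma hasSum_binom {d w : ℝ} (h0 : 0 < w) (h1 : w < 1) :
    HasSum (fun k : ℕ => poch d k / k.factorial * w ^ k) ((1 - w) ^ (-d)) := by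
  have h := (Real.one_div_one_sub_rpow_hasFPowerSeriesOnBall_zero d).hasSum (y := w) (by
    simp [Real.enorm_eq_ofReal h0.le, h1])
  simp only [zero_add, FormalMultilinearSeries.ofScalars_apply_eq, choose_eq, smul_eq_mul] at h
  rwa [one_div, ← Real.rpow_neg (by linarith)] at h

lemma q_series {d : ℝ} (hd : 0 ≤ d) (x w : ℝ) :
    q 0 (1 - x) * q 0 w * q (-d) x * q (-d) (1 - w) * q (-d) (x - w) =
    ∑' k : ℕ, ENNReal.ofReal (poch d k / k.factorial) *
      (q 0 (1 - x) * q (-d) x * (q k w * q (-d) (x - w))) := by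
  by_cases hx : 0 < 1 - x
  swap
  · simp [q_neg hx]
  by_cases hw : 0 < w
  swap
  · simp [q_neg hw]
  by_cases hxw : 0 < x - w
  swap
  · simp [q_neg hxw]
  have hw1 : 0 < 1 - w := by linarith
  have hs := hasSum_binom (d := d) hw (by linarith : w < 1)
  have : q (-d) (1 - w) = ∑' k : ℕ, ENNReal.ofReal (poch d k / k.factorial) * q k w := by
    rw [q_pos hw1, ← hs.tsum_eq, ENNReal.ofReal_tsum_of_nonneg _ hs.summable]
    · congr 1; ext k
      rw [q_pos hw, ENNReal.ofReal_mul (by have := poch_nonneg hd k; positivity), Real.rpow_natCast]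
    · intro k; have := poch_nonneg hd k; positivity
  rw [this, q_zero_pos hw, mul_one, mul_assoc, ← ENNReal.tsum_mul_right, ← ENNReal.tsum_mul_left]
  congr 1; ext k; ring

noncomputable def G (d x w : ℝ) : ℝ≥0∞ :=
  q 0 (1 - x) * q 0 w * q (-d) x * q (-d) (1 - w) * q (-d) (x - w)

@[fun_prop]
lemma G_meas {α : Type*} [MeasurableSpace α] (d : ℝ) {f g : α → ℝ} (hf : Measurable f)
    (hg : Measurable g) : Measurable fun p => G d (f p) (g p) := by
  unfold G; fun_prop

noncomputable def bt (d z : ℝ) : ℝ≥0∞ := q (-d) z * q (-d) (1 - z)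

@[fun_prop]
lemma bt_meas (d : ℝ) : Measurable (bt d) := by
  unfold bt; fun_prop

open ProbabilityTheory in
lemma G_inner {d : ℝ} (h0 : 0 ≤ d) (h1 : d < 1/2) (x : ℝ) :
    ∫⁻ w, G d x w = ∑' k : ℕ, ENNReal.ofReal (poch d k / k.factorial * beta (k+1) (1-d)) *
      (q (k + 1 - 2*d) x * q 0 (1 - x)) := by
  unfold G
  simp_rw [q_series h0]
  rw [lintegral_tsum (fun k => by fun_prop)]
  congr 1; ext k
  have hk : (0:ℝ) ≤ k := by positivity
  rw [lintegral_const_mul' _ _ (by finiteness),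
    lintegral_const_mul' _ _ (ENNReal.mul_ne_top (q_ne_top _ _) (q_ne_top _ _)),
    lint_conv (by linarith) (by linarith),
    ENNReal.ofReal_mul (by have := poch_nonneg h0 k; positivity),
    show (k:ℝ) + 1 - 2 * d = (-d) + (k + -d + 1) by ring, ← q_mul (-d) (k + -d + 1), show -d + 1 = 1 - d by ring]
  ring

noncomputable def Ai (d : ℝ) : ℝ≥0∞ := ∫⁻ x, ∫⁻ w, G d x w
noncomputable def D1 (d : ℝ) : ℝ≥0∞ := ∫⁻ x, ∫⁻ w, G d x w * ∫⁻ z, q 0 (z - x) * bt d z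
noncomputable def D2 (d : ℝ) : ℝ≥0∞ := ∫⁻ x, ∫⁻ w, G d x w * ∫⁻ z, q 0 (w - z) * bt d z
noncomputable def Ci (d : ℝ) : ℝ≥0∞ :=
  ∫⁻ x, ∫⁻ w, G d x w * ∫⁻ z, q 0 (x - z) * q 0 (z - w) * bt d z

open ProbabilityTheory in
lemma A_eq {d : ℝ} (h0 : 0 ≤ d) (h1 : d < 1/2) :
    Ai d = ∑' k : ℕ, ENNReal.ofReal (poch d k / k.factorial * beta (k+1) (1-d)) *
      ENNReal.ofReal (beta (k+2-2*d) 1) := by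
  unfold Ai
  simp_rw [G_inner h0 h1]
  rw [lintegral_tsum (fun k => by fun_prop)]
  congr 1; ext k
  have hk : (0:ℝ) ≤ k := by positivity
  rw [lintegral_const_mul' _ _ (by finiteness), lint_beta (by linarith) (by linarith)]
  congr 3 <;> ring_nf

lemma q_drop (d a x z : ℝ) : q a x * q 0 (1 - x) * (q 0 (z - x) * bt d z) =
    q a x * q 0 (z - x) * bt d z := by
  unfold bt
  by_cases h1 : 0 < 1 - z
  · by_cases h2 : 0 < z - x
    · rw [q_zero_pos (t := 1 - x) (by linarith)]; ring
    · simp [q_neg h2]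
  · simp [q_neg h1]

open ProbabilityTheory in
lemma D1_eq {d : ℝ} (h0 : 0 ≤ d) (h1 : d < 1/2) :
    D1 d = ∑' k : ℕ, ENNReal.ofReal (poch d k / k.factorial * beta (k+1) (1-d)) *
      (ENNReal.ofReal (beta (k+2-2*d) 1) * ENNReal.ofReal (beta (k+3-3*d) (1-d))) := by
  unfold D1
  have h : ∀ x, ∫⁻ w, G d x w * ∫⁻ z, q 0 (z - x) * bt d z =
      ∑' k : ℕ, ENNReal.ofReal (poch d k / k.factorial * beta (k+1) (1-d)) *
        ∫⁻ z, q (k + 1 - 2*d) x * q 0 (z - x) * bt d z := by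
    intro x
    rw [lintegral_mul_const _ (by fun_prop), G_inner h0 h1, ← ENNReal.tsum_mul_right]
    congr 1; ext k
    rw [mul_assoc, ← lintegral_const_mul _ (by fun_prop)]
    simp_rw [q_drop]
  simp_rw [h]
  rw [lintegral_tsum (fun k => by fun_prop)]
  congr 1; ext k
  have hk : (0:ℝ) ≤ k := by positivity
  rw [lintegral_const_mul' _ _ (by finiteness), lintegral_lintegral_swap (by unfold Function.uncurry; fun_prop)]
  congr 1
  have h2 : ∀ z, ∫⁻ x, q (k + 1 - 2*d) x * q 0 (z - x) * bt d z =
      ENNReal.ofReal (beta (k+2-2*d) 1) * (q (k + 2 - 3*d) z * q (-d) (1-z)) := by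
    intro z
    rw [lintegral_mul_const _ (by fun_prop), lint_conv (by linarith) (by linarith), bt,
      show (k:ℝ) + 2 - 3 * d = (k + 1 - 2*d + 0 + 1) + (-d) by ring,
      ← q_mul (k + 1 - 2*d + 0 + 1) (-d),
      show (k:ℝ) + 1 - 2*d + 1 = k + 2 - 2*d by ring, zero_add]
    ring
  simp_rw [h2]
  rw [lintegral_const_mul' _ _ (by finiteness), lint_beta (by linarith) (by linarith)]
  congr 3 <;> ring_nf

lemma G_refl (d x w : ℝ) : G d (1 - x) (1 - w) = G d w x := by
  unfold G
  rw [sub_sub_cancel, sub_sub_cancel, show 1 - x - (1 - w) = w - x by ring]; ring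

lemma bt_refl (d z : ℝ) : bt d (1 - z) = bt d z := by
  unfold bt; rw [sub_sub_cancel, mul_comm]

lemma D2_eq (d : ℝ) : D2 d = D1 d := by
  unfold D2 D1
  rw [lintegral_lintegral_swap (by unfold Function.uncurry; fun_prop)]
  rw [← lintegral_sub_left_eq_self _ 1]
  congr 1; ext x
  rw [← lintegral_sub_left_eq_self _ 1]
  congr 1; ext w
  rw [G_refl]
  congr 1
  rw [← lintegral_sub_left_eq_self _ 1]
  congr 1; ext z
  rw [bt_refl, show 1 - x - (1 - z) = z - x by ring]

open ProbabilityTheory in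
lemma CD {d : ℝ} (h1 : d < 1/2) :
    Ci d + D1 d + D2 d = ENNReal.ofReal (beta (1-d) (1-d)) * Ai d := by
  unfold Ci D1 D2 Ai
  rw [← lintegral_add_left (by fun_prop), ← lintegral_add_left (by fun_prop),
    ← lintegral_const_mul' _ _ (by finiteness)]
  congr 1; ext x
  rw [← lintegral_add_left (by fun_prop), ← lintegral_add_left (by fun_prop),
    ← lintegral_const_mul' _ _ (by finiteness)]
  congr 1; ext w
  by_cases hxw : 0 < x - w
  swap
  · simp [G, q_neg hxw]
  rw [← mul_add, ← mul_add, mul_comm]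
  congr 1
  rw [← lintegral_add_left (by fun_prop), ← lintegral_add_left (by fun_prop)]
  have := lint_beta (a := -d) (b := -d) (by linarith) (by linarith)
  rw [show -d + 1 = 1 - d by ring] at this
  rw [← this]
  apply lintegral_congr_ae
  have hx : ∀ᵐ z : ℝ, z ≠ x := by simp [ae_iff]
  have hw : ∀ᵐ z : ℝ, z ≠ w := by simp [ae_iff]
  filter_upwards [hx, hw] with z hx hw
  change _ = bt d z
  rcases lt_or_gt_of_ne hx with h | h
  · rw [q_zero_pos (t := x - z) (by linarith), q_neg (t := z - x) (by linarith)]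
    rcases lt_or_gt_of_ne hw with h' | h'
    · rw [q_zero_pos (t := w - z) (by linarith), q_neg (t := z - w) (by linarith)]; simp
    · rw [q_zero_pos (t := z - w) (by linarith), q_neg (t := w - z) (by linarith)]; simp
  · rw [q_zero_pos (t := z - x) (by linarith), q_neg (t := x - z) (by linarith),
     q_neg (t := w - z) (by linarith)]; simp

lemma A_fin {d : ℝ} (h0 : 0 ≤ d) (h1 : d < 1/2) : Ai d ≠ ∞ := by
  have hG : ∀ x w, G d x w ≤ q 0 (1 - x) * q (-d) x * (q 0 w * q (-(2*d)) (x - w)) := by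
    intro x w
    unfold G
    by_cases hx : 0 < 1 - x
    swap
    · simp [q_neg hx]
    by_cases hxw : 0 < x - w
    swap
    · simp [q_neg hxw]
    have : q (-d) (1 - w) ≤ q (-d) (x - w) := by
      rw [q_pos (by linarith), q_pos (by linarith)]
      apply ENNReal.ofReal_le_ofReal
      exact Real.rpow_le_rpow_of_nonpos hxw (by linarith) (by linarith)
    calc _ ≤ q 0 (1 - x) * q 0 w * q (-d) x * q (-d) (x - w) * q (-d) (x - w) := by gcongr
      _ = _ := by rw [show -(2*d) = -d + -d by ring, ← q_mul]; ring
  apply ne_top_of_le_ne_top _ (lintegral_mono fun x => lintegral_mono fun w => hG x w)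
  have : ∀ x, ∫⁻ w, q 0 (1 - x) * q (-d) x * (q 0 w * q (-(2*d)) (x - w)) =
      ENNReal.ofReal (ProbabilityTheory.beta (0+1) (-(2*d)+1)) *
        (q (-d + (0 + -(2*d) + 1)) x * q 0 (1 - x)) := by
    intro x
    rw [lintegral_const_mul _ (by fun_prop), lint_conv (by linarith) (by linarith),
      ← q_mul (-d) (0 + -(2*d) + 1)]
    ring
  simp_rw [this]
  rw [lintegral_const_mul _ (by fun_prop), lint_beta (by linarith) (by linarith)]
  finiteness

noncomputable def K (d y1 y2 y3 y4 y5 : ℝ) : ℝ≥0∞ :=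
  q 0 (1 - y1) * q 0 (y1 - y2) * q 0 (y2 - y3) * q 0 (y3 - y4) * q 0 (y4 - y5) * q 0 y5 *
  (q (-d) (y1 - y3) * q (-d) (y2 - y4) * q (-d) (y1 - y4) * q (-d) (y2 - y5) * q (-d) (y3 - y5))

@[fun_prop]
lemma K_meas {α : Type*} [MeasurableSpace α] (d : ℝ) {f1 f2 f3 f4 f5 : α → ℝ} (h1 : Measurable f1)
    (h2 : Measurable f2) (h3 : Measurable f3) (h4 : Measurable f4) (h5 : Measurable f5) :
    Measurable fun p => K d (f1 p) (f2 p) (f3 p) (f4 p) (f5 p) := by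
  unfold K; fun_prop

lemma K_zero {d y1 y2 y3 y4 y5 : ℝ}
    (h : ¬ (y1 < 1 ∧ y2 < y1 ∧ y3 < y2 ∧ y4 < y3 ∧ y5 < y4 ∧ 0 < y5)) :
    K d y1 y2 y3 y4 y5 = 0 := by
  by_contra hK
  apply h
  unfold K at hK
  simp only [mul_ne_zero_iff, ne_eq] at hK
  obtain ⟨⟨⟨⟨⟨⟨a1, a2⟩, a3⟩, a4⟩, a5⟩, a6⟩, -⟩ := hK
  have key : ∀ t, ¬ q 0 t = 0 → 0 < t := fun t ht => by
    by_contra h'; exact ht (q_neg h')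
  have := key _ a1
  have := key _ a2
  have := key _ a3
  have := key _ a4
  have := key _ a5
  have := key _ a6
  refine ⟨?_, ?_, ?_, ?_, ?_, ?_⟩ <;> linarith

lemma K_val {d y1 y2 y3 y4 y5 : ℝ} (a1 : y1 < 1) (a2 : y2 < y1) (a3 : y3 < y2) (a4 : y4 < y3)
    (a5 : y5 < y4) (a6 : 0 < y5) : (K d y1 y2 y3 y4 y5).toReal =
    (y1 - y3) ^ (-d) * (y2 - y4) ^ (-d) * (y1 - y4) ^ (-d) * (y2 - y5) ^ (-d) * (y3 - y5) ^ (-d) := by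
  have key : ∀ t, 0 < t → (q (-d) t).toReal = t ^ (-d) := fun t ht => by
    rw [q_pos ht, ENNReal.toReal_ofReal (by positivity)]
  unfold K
  rw [q_zero_pos (by linarith), q_zero_pos (by linarith), q_zero_pos (by linarith),
    q_zero_pos (by linarith), q_zero_pos (by linarith), q_zero_pos (by linarith)]
  simp only [ENNReal.toReal_mul, mul_one, one_mul]
  rw [key _ (by linarith), key _ (by linarith), key _ (by linarith), key _ (by linarith),
    key _ (by linarith)]

lemma step {a : ℝ} (ha : 0 ≤ a) (f : ℝ → ℝ≥0∞) (g : ℝ → ℝ) (hf : Measurable f)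
    (hfin : ∫⁻ y, f y ≠ ∞) (hz : ∀ y, ¬ (0 < y ∧ y < a) → f y = 0)
    (h : ∀ y, 0 < y → y < a → f y ≠ ∞ → g y = (f y).toReal) :
    ∫ y in (0:ℝ)..a, g y = (∫⁻ y, f y).toReal := by
  have hae : ∀ᵐ y, f y < ∞ := ae_lt_top hf hfin
  rw [intervalIntegral.integral_of_le ha, integral_Ioc_eq_integral_Ioo,
    ← integral_toReal hf.aemeasurable hae, ← setIntegral_eq_integral_of_forall_compl_eq_zero
      (s := Set.Ioo 0 a) (f := fun y => (f y).toReal) (fun y hy => by rw [hz y hy]; simp)]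
  apply integral_congr_ae
  filter_upwards [ae_restrict_of_ae hae, ae_restrict_mem measurableSet_Ioo] with y h1 h2
  exact h y h2.1 h2.2 h1.ne

noncomputable def J (d : ℝ) : ℝ≥0∞ := ∫⁻ y1, ∫⁻ y2, ∫⁻ y3, ∫⁻ y4, ∫⁻ y5, K d y1 y2 y3 y4 y5

lemma real_eq (d : ℝ) (hJ : J d ≠ ∞) :
    (∫ y1 in (0:ℝ)..1, ∫ y2 in (0:ℝ)..y1, ∫ y3 in (0:ℝ)..y2, ∫ y4 in (0:ℝ)..y3, ∫ y5 in (0:ℝ)..y4,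
      (y1 - y3) ^ (-d) * (y2 - y4) ^ (-d) * (y1 - y4) ^ (-d) * (y2 - y5) ^ (-d) * (y3 - y5) ^ (-d)) =
    (J d).toReal := by
  refine step zero_le_one _ _ (by fun_prop) hJ ?_ ?_
  · intro y1 hy
    have : ∀ y2 y3 y4 y5, K d y1 y2 y3 y4 y5 = 0 := fun y2 y3 y4 y5 => K_zero (fun h => hy
      ⟨by linarith, by linarith⟩)
    simp [this]
  intro y1 p1 l1 f1
  refine step p1.le _ _ (by fun_prop) f1 ?_ ?_
  · intro y2 hy
    have : ∀ y3 y4 y5, K d y1 y2 y3 y4 y5 = 0 := fun y3 y4 y5 => K_zero (fun h => hy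
      ⟨by linarith, by linarith⟩)
    simp [this]
  intro y2 p2 l2 f2
  refine step p2.le _ _ (by fun_prop) f2 ?_ ?_
  · intro y3 hy
    have : ∀ y4 y5, K d y1 y2 y3 y4 y5 = 0 := fun y4 y5 => K_zero (fun h => hy
      ⟨by linarith, by linarith⟩)
    simp [this]
  intro y3 p3 l3 f3
  refine step p3.le _ _ (by fun_prop) f3 ?_ ?_
  · intro y4 hy
    have : ∀ y5, K d y1 y2 y3 y4 y5 = 0 := fun y5 => K_zero (fun h => hy
      ⟨by linarith, by linarith⟩)
    simp [this]
  intro y4 p4 l4 f4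
  refine step p4.le _ _ (by fun_prop) f4 ?_ ?_
  · intro y5 hy
    exact K_zero (fun h => hy ⟨by linarith, by linarith⟩)
  intro y5 p5 l5 f5
  rw [K_val l1 l2 l3 l4 l5 p5]

lemma K_scale (d y5 x z w : ℝ) {L : ℝ} (hL : 0 < L) :
    K d (y5 + L) (y5 + L * x) (y5 + L * z) (y5 + L * w) y5 =
    ENNReal.ofReal (L ^ (-(5*d))) * (q 0 (1 - (y5 + L)) * q 0 y5) *
      (G d x w * (q 0 (x - z) * q 0 (z - w) * bt d z)) := by
  unfold K G bt
  rw [show y5 + L - (y5 + L * x) = L * (1 - x) by ring,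
    show y5 + L * x - (y5 + L * z) = L * (x - z) by ring,
    show y5 + L * z - (y5 + L * w) = L * (z - w) by ring,
    show y5 + L * w - y5 = L * w by ring,
    show y5 + L - (y5 + L * z) = L * (1 - z) by ring,
    show y5 + L * x - (y5 + L * w) = L * (x - w) by ring,
    show y5 + L - (y5 + L * w) = L * (1 - w) by ring,
    show y5 + L * x - y5 = L * x by ring,
    show y5 + L * z - y5 = L * z by ring]
  simp only [q_scale _ _ hL, Real.rpow_zero, ENNReal.ofReal_one, one_mul]
  have : ENNReal.ofReal (L ^ (-(5*d))) = ENNReal.ofReal (L ^ (-d)) ^ 5 := by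
    rw [← ENNReal.ofReal_pow (by positivity), ← Real.rpow_natCast, ← Real.rpow_mul hL.le]
    congr 2; push_cast; ring
  rw [this]; ring

lemma inner_eq (d y1 y5 : ℝ) : ∫⁻ y2, ∫⁻ y3, ∫⁻ y4, K d y1 y2 y3 y4 y5 =
    q 0 (1 - y1) * (q 0 y5 * q (3 - 5*d) (y1 - y5)) * Ci d := by
  by_cases h : 0 < y1 - y5
  swap
  · have : ∀ y2 y3 y4, K d y1 y2 y3 y4 y5 = 0 := fun y2 y3 y4 => K_zero (fun h' => h (by linarith))
    simp [this, q_neg h]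
  obtain ⟨L, rfl⟩ : ∃ L, y1 = y5 + L := ⟨y1 - y5, by ring⟩
  have hL : 0 < L := by linarith
  have e1 : ∀ x, ∫⁻ y3, ∫⁻ y4, K d (y5 + L) (y5 + L * x) y3 y4 y5 =
     ENNReal.ofReal L ^ 2 * (ENNReal.ofReal (L ^ (-(5*d))) * (q 0 (1 - (y5 + L)) * q 0 y5)) *
      ∫⁻ w, G d x w * ∫⁻ z, (q 0 (x - z) * q 0 (z - w) * bt d z) := by
    intro x
    rw [lint_affine _ (by fun_prop) y5 hL]
    have e2 : ∀ z, ∫⁻ y4, K d (y5 + L) (y5 + L * x) (y5 + L * z) y4 y5 =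
      ENNReal.ofReal L * (ENNReal.ofReal (L ^ (-(5*d))) * (q 0 (1 - (y5 + L)) * q 0 y5)) *
       ∫⁻ w, G d x w * (q 0 (x - z) * q 0 (z - w) * bt d z) := by
      intro z
      rw [lint_affine _ (by fun_prop) y5 hL]
      simp_rw [K_scale _ _ _ _ _ hL]
      rw [lintegral_const_mul _ (by fun_prop)]; ring
    simp_rw [e2]
    rw [lintegral_const_mul _ (by fun_prop),
      lintegral_lintegral_swap (by unfold Function.uncurry; fun_prop)]
    have e3 : ∀ w, ∫⁻ z, G d x w * (q 0 (x - z) * q 0 (z - w) * bt d z) =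
        G d x w * ∫⁻ z, (q 0 (x - z) * q 0 (z - w) * bt d z) := fun w =>
      lintegral_const_mul _ (by fun_prop)
    simp_rw [e3]
    ring
  rw [lint_affine _ (by fun_prop) y5 hL]
  simp_rw [e1]
  rw [lintegral_const_mul _ (by fun_prop), Ci, add_sub_cancel_left, q_pos hL]
  have : ENNReal.ofReal (L ^ (3 - 5*d)) = ENNReal.ofReal (L ^ (-(5*d))) * ENNReal.ofReal L ^ 3 := by
    rw [← ENNReal.ofReal_pow (by positivity), ← ENNReal.ofReal_mul (by positivity),
      ← Real.rpow_natCast, ← Real.rpow_add hL]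
    congr 2; push_cast; ring
  rw [this]; ring

open ProbabilityTheory in
lemma J_eq {d : ℝ} (h1 : d < 1/2) : J d =
    ENNReal.ofReal (beta 1 (4-5*d)) * ENNReal.ofReal (beta (5-5*d) 1) * Ci d := by
  unfold J
  have e : ∀ y1, ∫⁻ y2, ∫⁻ y3, ∫⁻ y4, ∫⁻ y5, K d y1 y2 y3 y4 y5 =
      ∫⁻ y5, ∫⁻ y2, ∫⁻ y3, ∫⁻ y4, K d y1 y2 y3 y4 y5 := by
    intro y1
    exact Eq.trans (lintegral_congr fun y2 => Eq.trans (lintegral_congr fun y3 =>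
      lintegral_lintegral_swap (by unfold Function.uncurry; fun_prop))
      (lintegral_lintegral_swap (by unfold Function.uncurry; fun_prop)))
      (lintegral_lintegral_swap (by unfold Function.uncurry; fun_prop))
  simp_rw [e, inner_eq]
  have e2 : ∀ y1, ∫⁻ y5, q 0 (1 - y1) * (q 0 y5 * q (3 - 5*d) (y1 - y5)) * Ci d =
      (ENNReal.ofReal (beta 1 (4-5*d)) * (q (4-5*d) y1 * q 0 (1 - y1))) * Ci d := by
    intro y1
    rw [lintegral_mul_const _ (by fun_prop), lintegral_const_mul _ (by fun_prop),
      lint_conv (by linarith) (by linarith), show (0:ℝ) + 1 = 1 by ring,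
      show 3 - 5 * d + 1 = 4 - 5 * d by ring, show 0 + (3 - 5 * d) + 1 = 4 - 5 * d by ring]
    ring
  simp_rw [e2]
  rw [lintegral_mul_const _ (by fun_prop), lintegral_const_mul _ (by fun_prop),
      lint_beta (by linarith) (by linarith), show (0:ℝ) + 1 = 1 by ring,
      show 4 - 5 * d + 1 = 5 - 5 * d by ring]

open ProbabilityTheory in
lemma beta_one {s : ℝ} (hs : 0 < s) : beta s 1 = 1 / s := by
  have := Real.Gamma_pos_of_pos hs
  rw [beta, Real.Gamma_one, Real.Gamma_add_one hs.ne']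
  field_simp

open ProbabilityTheory in
lemma beta_one' {s : ℝ} (hs : 0 < s) : beta 1 s = 1 / s := by
  have := Real.Gamma_pos_of_pos hs
  rw [beta, Real.Gamma_one, add_comm, Real.Gamma_add_one hs.ne']
  field_simp

lemma poch_shift {s : ℝ} (k : ℕ) : poch (s+1) k * s = poch s k * (s + k) := by
  induction k with
  | zero => simp [poch]
  | succ k ih =>
    rw [poch_succ, poch_succ, mul_right_comm, ih]; push_cast; ring

open ProbabilityTheory in
lemma coef {d : ℝ} (h1 : d < 1/2) (k : ℕ) :
    poch d k / k.factorial * beta (k+1) (1-d) = poch d k / ((1 - d) * poch (2-d) k) := by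
  have g := Real.Gamma_pos_of_pos (show 0 < 1 - d by linarith)
  have p := poch_pos (show 0 < 2 - d by linarith) k
  have hd : 0 < 1 - d := by linarith
  rw [beta, show (k:ℝ) + 1 + (1 - d) = (2 - d) + k by ring, Gamma_add_nat (by linarith),
    Real.Gamma_nat_eq_factorial, show 2 - d = (1 - d) + 1 by ring, Real.Gamma_add_one hd.ne']
  rw [show 2 - d = (1 - d) + 1 by ring] at p
  field_simp

open ProbabilityTheory in
lemma A_real {d : ℝ} (h0 : 0 ≤ d) (h1 : d < 1/2) :
    (Ai d).toReal = 1 / (2 * (1-d)^2) * F32 1 d (2-2*d) (2-d) (3-2*d) := by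
  rw [A_eq h0 h1, ENNReal.tsum_toReal_eq (fun k => by finiteness), F32, ← tsum_mul_left]
  congr 1; ext k
  have hk : (0:ℝ) ≤ k := by positivity
  have p0 := poch_nonneg h0 k
  have p1 := poch_pos (show 0 < 2 - d by linarith) k
  have p2 := poch_pos (show 0 < 2 - 2*d by linarith) k
  have p3 := poch_pos (show 0 < 3 - 2*d by linarith) k
  have s : poch (3-2*d) k * (2-2*d) = poch (2-2*d) k * ((2-2*d) + k) := by
    rw [← poch_shift]; ring_nf
  have hd : 0 < 1 - d := by linarith
  have hs : 0 < k + 2 - 2*d := by linarith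
  have hfr : 1 / (k + 2 - 2*d) = poch (2-2*d) k / (poch (3-2*d) k * (2 * (1-d))) := by
    rw [div_eq_div_iff hs.ne' (by positivity)]
    linear_combination s
  rw [coef h1, beta_one hs, hfr, ENNReal.toReal_mul, ENNReal.toReal_ofReal (by positivity),
    ENNReal.toReal_ofReal (by positivity), poch_one]
  generalize poch (2-2*d) k = P2 at *
  generalize poch (3-2*d) k = P3 at *
  generalize poch (2-d) k = P1 at *
  generalize poch (3-3*d) k = P5 at *
  generalize poch (4-4*d) k = P4 at *
  field_simp

open ProbabilityTheory in
lemma D1_real {d : ℝ} (h0 : 0 ≤ d) (h1 : d < 1/2) :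
    (D1 d).toReal = Gamma (1-d) / (2 * (1-d)^2) * (Gamma (3-3*d) / Gamma (4-4*d)) *
      F43 1 d (2-2*d) (3-3*d) (2-d) (3-2*d) (4-4*d) := by
  rw [D1_eq h0 h1, ENNReal.tsum_toReal_eq (fun k => by finiteness), F43, ← tsum_mul_left]
  congr 1; ext k
  have hk : (0:ℝ) ≤ k := by positivity
  have p0 := poch_nonneg h0 k
  have p1 := poch_pos (show 0 < 2 - d by linarith) k
  have p2 := poch_pos (show 0 < 2 - 2*d by linarith) k
  have p3 := poch_pos (show 0 < 3 - 2*d by linarith) k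
  have p4 := poch_pos (show 0 < 4 - 4*d by linarith) k
  have p5 := poch_pos (show 0 < 3 - 3*d by linarith) k
  have g1 := Real.Gamma_pos_of_pos (show 0 < 1 - d by linarith)
  have g2 := Real.Gamma_pos_of_pos (show 0 < 3 - 3*d by linarith)
  have g3 := Real.Gamma_pos_of_pos (show 0 < 4 - 4*d by linarith)
  have s : poch (3-2*d) k * (2-2*d) = poch (2-2*d) k * ((2-2*d) + k) := by
    rw [← poch_shift]; ring_nf
  have hd : 0 < 1 - d := by linarith
  have hs : 0 < k + 2 - 2*d := by linarith
  have hb : beta (k+3-3*d) (1-d) =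
      poch (3-3*d) k * Gamma (3-3*d) * Gamma (1-d) / (poch (4-4*d) k * Gamma (4-4*d)) := by
    rw [beta, show (k:ℝ) + 3 - 3*d + (1 - d) = (4-4*d) + k by ring,
      show (k:ℝ) + 3 - 3*d = (3-3*d) + k by ring, Gamma_add_nat (by linarith),
      Gamma_add_nat (by linarith)]
  have hfr : 1 / (k + 2 - 2*d) = poch (2-2*d) k / (poch (3-2*d) k * (2 * (1-d))) := by
    rw [div_eq_div_iff hs.ne' (by positivity)]
    linear_combination s
  rw [coef h1, beta_one hs, hfr, hb, ENNReal.toReal_mul, ENNReal.toReal_mul,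
    ENNReal.toReal_ofReal (by positivity), ENNReal.toReal_ofReal (by positivity),
    ENNReal.toReal_ofReal (by positivity), poch_one]
  generalize poch (2-2*d) k = P2 at *
  generalize poch (3-2*d) k = P3 at *
  generalize poch (2-d) k = P1 at *
  generalize poch (3-3*d) k = P5 at *
  generalize poch (4-4*d) k = P4 at *
  field_simp

theorem stmt12 (d : ℝ) (h0 : 0 ≤ d) (h1 : d < 1/2) :
    (∫ y1 in (0:ℝ)..1, ∫ y2 in (0:ℝ)..y1, ∫ y3 in (0:ℝ)..y2, ∫ y4 in (0:ℝ)..y3, ∫ y5 in (0:ℝ)..y4,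
      (y1 - y3) ^ (-d) * (y2 - y4) ^ (-d) * (y1 - y4) ^ (-d) * (y2 - y5) ^ (-d) * (y3 - y5) ^ (-d)) =
    Gamma (1-d) ^ 2 / (2 * (1-d) ^ 2) * (Gamma (4-5*d) / (Gamma (6-5*d) * Gamma (2-2*d))) *
      F32 1 d (2-2*d) (2-d) (3-2*d) -
      Gamma (1-d) / (1-d) ^ 2 * (Gamma (3-3*d) / Gamma (4-4*d)) * (Gamma (4-5*d) / Gamma (6-5*d)) *
      F43 1 d (2-2*d) (3-3*d) (2-d) (3-2*d) (4-4*d) := by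
  have hA := A_fin h0 h1
  have hCD := CD h1
  have hfin : Ci d + D1 d + D2 d ≠ ∞ := by rw [hCD]; finiteness
  have hC : Ci d ≠ ∞ := fun h => hfin (by simp [h])
  have hD : D1 d ≠ ∞ := fun h => hfin (by simp [h])
  have hJ : J d ≠ ∞ := by rw [J_eq h1]; finiteness
  have hR := congrArg ENNReal.toReal hCD
  rw [D2_eq, ENNReal.toReal_add (by finiteness) hD, ENNReal.toReal_add hC hD, ENNReal.toReal_mul,
    ENNReal.toReal_ofReal (ProbabilityTheory.beta_pos (by linarith) (by linarith)).le,
    A_real h0 h1, D1_real h0 h1, ProbabilityTheory.beta,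
    show 1 - d + (1 - d) = 2 - 2*d by ring] at hR
  rw [real_eq d hJ, J_eq h1, beta_one' (by linarith), beta_one (by linarith), ENNReal.toReal_mul,
    ENNReal.toReal_mul, ENNReal.toReal_ofReal (one_div_nonneg.2 (by linarith)),
    ENNReal.toReal_ofReal (one_div_nonneg.2 (by linarith))]
  have hG : Gamma (6 - 5*d) = (5-5*d) * ((4-5*d) * Gamma (4-5*d)) := by
    rw [← Real.Gamma_add_one (by linarith), ← show 5 - 5*d = 4 - 5*d + 1 by ring,
      ← Real.Gamma_add_one (by linarith)]
    ring_nf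
  have g := Real.Gamma_pos_of_pos (show 0 < 4 - 5*d by linarith)
  have hq : Gamma (4-5*d) / Gamma (6-5*d) = 1 / (4-5*d) * (1 / (5-5*d)) := by
    rw [hG]
    have : 0 < 5 - 5*d := by linarith
    have : 0 < 4 - 5*d := by linarith
    field_simp
  rw [← hq, ← div_div (Gamma (4-5*d))]
  generalize (1-d)^2 = e at *
  linear_combination (Gamma (4-5*d) / Gamma (6-5*d)) * hR
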